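/- arXiv:2402.06108 — 6 statements merged into one kernel-verified Lean document; each statement's English description precedes it below -/
import Mathlib

section
/- Let G¹ and G² be real symmetric N×N matrices such that I + G¹ and I + G² are P-matrices, and let κ ∈ [0,1]. Then I + κ·G¹ + (1−κ)·G² is a P-matrix. -/
/-- `M` is a P-matrix: every principal submatrix (obtained by keeping the rows and
columns indexed by a set `s`) has strictly positive determinant. -/
def IsPMatrix {m : Type*} [Fintype m] [DecidableEq m] (M : Matrix m m ℝ) : Prop :=
  ∀ s : Finset m,
    0 < (M.submatrix (fun i : s => (i : m)) (fun j : s => (j : m))).det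

/-- Principal minors of a P-matrix indexed by an injective map are positive. -/
theorem IsPMatrix.det_submatrix_pos {m ι : Type*} [Fintype m] [DecidableEq m] [Fintype ι]
    [DecidableEq ι] {M : Matrix m m ℝ} (hM : IsPMatrix M) {f : ι → m}
    (hf : Function.Injective f) : 0 < (M.submatrix f f).det := by
  let e : ι ≃ (Finset.univ.image f : Finset m) :=
    Equiv.ofBijective (fun i => ⟨f i, Finset.mem_image_of_mem f (Finset.mem_univ i)⟩)
      ⟨fun i j h => hf (congrArg Subtype.val h), fun ⟨x, hx⟩ => by
        obtain ⟨i, -, rfl⟩ := Finset.mem_image.mp hx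
        exact ⟨i, rfl⟩⟩
  have h := hM (Finset.univ.image f)
  rw [← Matrix.det_submatrix_equiv_self e, Matrix.submatrix_submatrix] at h
  exact h

/-- A Hermitian bordering of a positive definite real matrix by one row and column is positive
definite as soon as its determinant is positive. -/
theorem Matrix.PosDef.fromBlocks_unit {ι : Type*} [Fintype ι] [DecidableEq ι]
    {A : Matrix ι ι ℝ} (hA : A.PosDef) (B : Matrix ι Unit ℝ) (D : Matrix Unit Unit ℝ)
    (hdet : 0 < (Matrix.fromBlocks A B B.conjTranspose D).det) :
    (Matrix.fromBlocks A B B.conjTranspose D).PosDef := by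
  have : Invertible A := hA.isUnit.invertible
  have hS : 0 < (D - B.conjTranspose * A⁻¹ * B).det := by
    rw [Matrix.det_fromBlocks₁₁, Matrix.invOf_eq_nonsing_inv] at hdet
    exact (pos_iff_pos_of_mul_pos hdet).mp hA.det_pos
  refine ((hA.fromBlocks₁₁ B D).mpr ?_).posDef_iff_det_ne_zero.mpr hdet.ne'
  rw [Matrix.det_unique] at hS
  generalize D - B.conjTranspose * A⁻¹ * B = S at hS
  have hSd : S = Matrix.diagonal fun _ => S default default := by
    ext i j
    simp
  rw [hSd]
  exact Matrix.PosSemidef.diagonal fun _ => hS.le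

/-- A real Hermitian P-matrix is positive definite. -/
theorem IsPMatrix.posDef {m : Type*} [Fintype m] [DecidableEq m] {M : Matrix m m ℝ}
    (hM : IsPMatrix M) (hH : M.IsHermitian) : M.PosDef := by
  have key (s : Finset m) : (M.submatrix ((↑) : s → m) (↑)).PosDef := by
    induction s using Finset.induction_on with
    | empty => exact ⟨hH.submatrix _, fun x hx => (hx (Subsingleton.elim _ _)).elim⟩
    | insert a s ha ih =>
      let f : s ⊕ Unit → m := Sum.elim (↑) fun _ => a
      have hf : Function.Injective f :=
        Subtype.val_injective.sumElim (Function.injective_of_subsingleton _)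
          fun x _ h => ha (h ▸ x.2)
      have hblocks : M.submatrix f f = Matrix.fromBlocks (M.submatrix (↑) (↑))
          (M.submatrix (↑) fun _ => a) (M.submatrix (↑) fun _ => a).conjTranspose
          (M.submatrix (fun _ => a) fun _ => a) := by
        rw [Matrix.conjTranspose_submatrix, hH.eq]
        ext (i | i) (j | j) <;> rfl
      have hpos : (M.submatrix f f).PosDef := by
        have hdet := hM.det_submatrix_pos hf
        rw [hblocks] at hdet ⊢
        exact ih.fromBlocks_unit _ _ hdet
      have hsurj (x : (insert a s : Finset m)) : ∃ y, f y = x := by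
        rcases Finset.mem_insert.mp x.2 with h | h
        · exact ⟨Sum.inr (), h.symm⟩
        · exact ⟨Sum.inl ⟨x, h⟩, rfl⟩
      choose g hg using hsurj
      have hginj : Function.Injective g := fun x y h =>
        Subtype.ext ((hg x).symm.trans ((congrArg f h).trans (hg y)))
      have hfg : f ∘ g = Subtype.val := funext hg
      simpa only [Matrix.submatrix_submatrix, hfg] using hpos.submatrix hginj
  exact (key Finset.univ).submatrix (e := fun i => ⟨i, Finset.mem_univ i⟩)
    fun i j h => congrArg Subtype.val h

/-- A positive definite real matrix is a P-matrix. -/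
theorem Matrix.PosDef.isPMatrix {m : Type*} [Fintype m] [DecidableEq m] {M : Matrix m m ℝ}
    (hM : M.PosDef) : IsPMatrix M :=
  fun _ => (hM.submatrix Subtype.val_injective).det_pos


/-- If `G¹`, `G²` are symmetric and `I + G¹`, `I + G²` are P-matrices,
then for `κ ∈ [0,1]` the multiplex matrix `I + κ G¹ + (1−κ) G²` is a P-matrix. -/
theorem multiplex_pMatrix_of_symm_pMatrices {N : ℕ} (G1 G2 : Matrix (Fin N) (Fin N) ℝ)
    (hG1 : G1.IsHermitian) (hG2 : G2.IsHermitian)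
    (hP1 : IsPMatrix (1 + G1)) (hP2 : IsPMatrix (1 + G2))
    (κ : ℝ) (hκ : κ ∈ Set.Icc (0 : ℝ) 1) :
    IsPMatrix (1 + (κ • G1 + (1 - κ) • G2)) := by
  have h1 := hP1.posDef (Matrix.isHermitian_one.add hG1)
  have h2 := hP2.posDef (Matrix.isHermitian_one.add hG2)
  have hsum : 1 + (κ • G1 + (1 - κ) • G2) = κ • (1 + G1) + (1 - κ) • (1 + G2) := by
    module
  rw [hsum]
  refine Matrix.PosDef.isPMatrix ?_
  rcases hκ.1.eq_or_lt with rfl | h0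
  · simpa using h2
  · exact (h1.smul h0).add_posSemidef (h2.posSemidef.smul (sub_nonneg.mpr hκ.2))
end

section
/- Let G¹ and G² be real N×N matrices with zero diagonal such that I + G¹ and I + G² are B-matrices, and let κ ∈ [0,1]. Then I + κ·G¹ + (1−κ)·G² is a P-matrix. -/
/-- `A` is a B-matrix: every row has positive sum, and the row average strictly dominates
every off-diagonal entry of that row. -/
def IsBMatrix {N : ℕ} (A : Matrix (Fin N) (Fin N) ℝ) : Prop :=
  ∀ i, (0 < ∑ j, A i j) ∧ ∀ k, k ≠ i → A i k < (1 / (N : ℝ)) * ∑ j, A i j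

/-- A matrix whose off-diagonal entries in each row are at most a nonnegative `r i`, and whose rows
have positive sum after subtracting `r i` from every entry, is nonsingular. -/
theorem det_ne_zero_of_offDiag_le {n : Type*} [Fintype n] [DecidableEq n]
    {M : Matrix n n ℝ} {r : n → ℝ} (hr : ∀ i, 0 ≤ r i)
    (hoff : ∀ i j, j ≠ i → M i j ≤ r i) (hsum : ∀ i, 0 < ∑ j, (M i j - r i)) :
    M.det ≠ 0 := by
  have nonpos : ∀ x : n → ℝ, M.mulVec x = 0 → 0 ≤ ∑ j, x j → ∀ i, x i ≤ 0 := by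
    intro x hx hσ i
    obtain ⟨m, -, hm⟩ := Finset.exists_max_image Finset.univ x ⟨i, Finset.mem_univ i⟩
    refine (hm i (Finset.mem_univ i)).trans ?_
    by_contra! hpos
    have hxm : ∑ j, M m j * x j = 0 := congrFun hx m
    have hle : (∑ j, (M m j - r m)) * x m ≤ ∑ j, (M m j - r m) * x j := by
      rw [Finset.sum_mul]
      refine Finset.sum_le_sum fun j _ => ?_
      rcases eq_or_ne j m with rfl | hj
      · exact le_rfl
      · exact mul_le_mul_of_nonpos_left (hm j (Finset.mem_univ j)) (by linarith [hoff m j hj])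
    have hsplit : ∑ j, (M m j - r m) * x j = -(r m * ∑ j, x j) := by
      simp only [sub_mul, Finset.sum_sub_distrib, hxm, ← Finset.mul_sum, zero_sub]
    linarith [mul_pos (hsum m) hpos, mul_nonneg (hr m) hσ]
  have eq_zero : ∀ x : n → ℝ, M.mulVec x = 0 → 0 ≤ ∑ j, x j → x = 0 := by
    intro x hx hσ
    have hx0 := nonpos x hx hσ
    have h0 : ∑ j, x j = 0 := le_antisymm (Finset.sum_nonpos fun j _ => hx0 j) hσ
    funext j
    exact (Finset.sum_eq_zero_iff_of_nonpos fun j _ => hx0 j).1 h0 j (Finset.mem_univ j)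
  intro hdet
  obtain ⟨x, hne, hx⟩ := Matrix.exists_mulVec_eq_zero_iff.2 hdet
  rcases le_total 0 (∑ j, x j) with hσ | hσ
  · exact hne (eq_zero x hx hσ)
  · refine hne (neg_eq_zero.1 (eq_zero (-x) (by rw [Matrix.mulVec_neg, hx, neg_zero]) ?_))
    simpa [Finset.sum_neg_distrib] using hσ

/-- The determinant of a matrix as in `det_ne_zero_of_offDiag_le` is positive, since the segment
joining it to the identity consists of such matrices. -/
theorem det_pos_of_offDiag_le {n : Type*} [Fintype n] [DecidableEq n]
    {M : Matrix n n ℝ} {r : n → ℝ} (hr : ∀ i, 0 ≤ r i)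
    (hoff : ∀ i j, j ≠ i → M i j ≤ r i) (hsum : ∀ i, 0 < ∑ j, (M i j - r i)) :
    0 < M.det := by
  let f : ℝ → ℝ := fun t => ((1 - t) • (1 : Matrix n n ℝ) + t • M).det
  have hf : Continuous f := by
    refine Continuous.matrix_det ?_
    fun_prop
  have hne : ∀ t ∈ Set.Icc (0 : ℝ) 1, f t ≠ 0 := by
    rintro t ⟨ht0, ht1⟩
    refine det_ne_zero_of_offDiag_le (r := fun i => t * r i) (fun i => mul_nonneg ht0 (hr i)) ?_ ?_
    · intro i j hj
      simpa [Matrix.one_apply_ne hj.symm] using mul_le_mul_of_nonneg_left (hoff i j hj) ht0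
    · intro i
      have key : ∑ j, (((1 - t) • (1 : Matrix n n ℝ) + t • M) i j - t * r i)
          = (1 - t) + t * ∑ j, (M i j - r i) := by
        calc _ = ∑ j, ((1 - t) * (1 : Matrix n n ℝ) i j + t * (M i j - r i)) :=
              Finset.sum_congr rfl fun j _ => by
                simp only [Matrix.add_apply, Matrix.smul_apply, smul_eq_mul]; ring
          _ = _ := by
              rw [Finset.sum_add_distrib, ← Finset.mul_sum, ← Finset.mul_sum]
              simp [Matrix.one_apply]
      rw [key]
      rcases ht0.eq_or_lt with rfl | ht
      · norm_num
      · linarith [mul_pos ht (hsum i)]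
  have h0 : f 0 = 1 := by simp [f]
  have h1 : f 1 = M.det := by simp [f]
  rw [← h1]
  by_contra! hle
  obtain ⟨t, ht, hft⟩ := intermediate_value_Icc' zero_le_one hf.continuousOn
    (show (0 : ℝ) ∈ Set.Icc (f 1) (f 0) from ⟨hle, by rw [h0]; exact zero_le_one⟩)
  exact hne t ht hft

theorem IsBMatrix.isPMatrix {N : ℕ} {A : Matrix (Fin N) (Fin N) ℝ} (hA : IsBMatrix A) :
    IsPMatrix A := by
  have hexists : ∀ i, ∃ r : ℝ, 0 ≤ r ∧ (∀ j, j ≠ i → A i j ≤ r) ∧ 0 < ∑ j, (A i j - r) := by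
    intro i
    have hN : (0 : ℝ) < N := Nat.cast_pos.2 i.pos
    let g : Fin N → ℝ := fun j => if j = i then 0 else A i j
    have hne : (Finset.univ : Finset (Fin N)).Nonempty := ⟨i, Finset.mem_univ i⟩
    refine ⟨Finset.univ.sup' hne g, ?_, fun j hj => ?_, ?_⟩
    · exact (if_pos rfl).ge.trans (Finset.le_sup' g (Finset.mem_univ i))
    · exact (if_neg hj).ge.trans (Finset.le_sup' g (Finset.mem_univ j))
    · have hlt : Finset.univ.sup' hne g < (1 / (N : ℝ)) * ∑ j, A i j := by
        refine (Finset.sup'_lt_iff hne).2 fun j _ => ?_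
        by_cases hj : j = i
        · simpa [g, hj] using mul_pos (inv_pos.2 hN) (hA i).1
        · simpa [g, hj] using (hA i).2 j hj
      rw [one_div, inv_mul_eq_div, lt_div_iff₀ hN] at hlt
      rw [Finset.sum_sub_distrib, Finset.sum_const, Finset.card_univ, Fintype.card_fin,
        nsmul_eq_mul]
      linarith
  choose r hr hoff hsum using hexists
  intro s
  refine det_pos_of_offDiag_le (r := fun i : s => r i) (fun i => hr i) ?_ fun i => ?_
  · exact fun i j hj => hoff i j fun h => hj (Subtype.ext h)
  · refine (hsum i).trans_le ?_
    simp only [Matrix.submatrix_apply]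
    rw [Finset.sum_coe_sort s fun j => A i j - r i, ← Finset.sum_add_sum_compl s]
    have : ∑ j ∈ sᶜ, (A i j - r i) ≤ 0 := Finset.sum_nonpos fun j hj => by
      have hji : j ≠ i := fun h => Finset.mem_compl.1 hj (h ▸ i.2)
      linarith [hoff i j hji]
    linarith

theorem IsBMatrix.convex_comb {N : ℕ} {A B : Matrix (Fin N) (Fin N) ℝ} (hA : IsBMatrix A)
    (hB : IsBMatrix B) {a b : ℝ} (ha : 0 ≤ a) (hb : 0 ≤ b) (hab : a + b = 1) :
    IsBMatrix (a • A + b • B) := by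
  have hcomb : ∀ {x y x' y' : ℝ}, x < x' → y < y' → a * x + b * y < a * x' + b * y' := by
    intro x y x' y' hx hy
    rcases ha.eq_or_lt with rfl | ha'
    · obtain rfl : b = 1 := by linarith
      linarith
    · linarith [mul_lt_mul_of_pos_left hx ha', mul_le_mul_of_nonneg_left hy.le hb]
  intro i
  have hrow : ∑ j, (a • A + b • B) i j = a * ∑ j, A i j + b * ∑ j, B i j := by
    simp [Finset.sum_add_distrib, Finset.mul_sum]
  rw [hrow]
  refine ⟨by simpa using hcomb (hA i).1 (hB i).1, fun k hk => ?_⟩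
  calc (a • A + b • B) i k = a * A i k + b * B i k := by simp
    _ < _ := hcomb ((hA i).2 k hk) ((hB i).2 k hk)
    _ = _ := by ring

/-- If `I + G¹` and `I + G²` are B-matrices, then for `κ ∈ [0,1]` the
matrix `I + κ G¹ + (1−κ) G²` is a P-matrix. -/
theorem multiplex_pMatrix_of_bMatrices {N : ℕ} (G1 G2 : Matrix (Fin N) (Fin N) ℝ)
    (hd1 : ∀ i, G1 i i = 0) (hd2 : ∀ i, G2 i i = 0)
    (hB1 : IsBMatrix (1 + G1)) (hB2 : IsBMatrix (1 + G2))
    (κ : ℝ) (hκ : κ ∈ Set.Icc (0 : ℝ) 1) :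
    IsPMatrix (1 + (κ • G1 + (1 - κ) • G2)) := by
  have hconv := hB1.convex_comb hB2 hκ.1 (sub_nonneg.2 hκ.2) (add_sub_cancel κ 1)
  have heq : κ • (1 + G1) + (1 - κ) • (1 + G2) = 1 + (κ • G1 + (1 - κ) • G2) := by
    module
  exact heq ▸ hconv.isPMatrix
end

section
/- Let G¹, G², G¹², G²¹ be real N×N matrices such that I + G¹ and I + G² are P-matrices, and let G⧉ be the associated supra-adjacency matrix. If det(I + G² − G²¹·(I + G¹)⁻¹·G¹²) ≤ 0, or det(I + G¹ − G¹²·(I + G²)⁻¹·G²¹) ≤ 0, then det(I + G⧉) ≤ 0 and I + G⧉ is not a P-matrix. -/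
theorem IsPMatrix.det_pos {m : Type*} [Fintype m] [DecidableEq m] {M : Matrix m m ℝ}
    (hM : IsPMatrix M) : 0 < M.det := by
  rw [← Matrix.det_submatrix_equiv_self
    (Equiv.subtypeUnivEquiv (Finset.mem_univ (α := m))) M]
  exact hM Finset.univ

/-- If `I + G¹` and `I + G²` are P-matrices but one of the Schur
complements of `I + G⧉` has nonpositive determinant, then `det(I + G⧉) ≤ 0` and
`I + G⧉` is not a P-matrix. -/
theorem multilayer_not_pMatrix_of_schur_failure {N : ℕ}
    (G1 G2 G12 G21 : Matrix (Fin N) (Fin N) ℝ)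
    (hP1 : IsPMatrix (1 + G1)) (hP2 : IsPMatrix (1 + G2))
    (h : (1 + G2 - G21 * (1 + G1)⁻¹ * G12).det ≤ 0 ∨
         (1 + G1 - G12 * (1 + G2)⁻¹ * G21).det ≤ 0) :
    (1 + Matrix.fromBlocks G1 G12 G21 G2).det ≤ 0 ∧
      ¬ IsPMatrix (1 + Matrix.fromBlocks G1 G12 G21 G2) := by
  have hdet : (1 + Matrix.fromBlocks G1 G12 G21 G2).det ≤ 0 := by
    have h1 := hP1.det_pos
    have h2 := hP2.det_pos
    let _ := Matrix.invertibleOfIsUnitDet _ h1.ne'.isUnit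
    let _ := Matrix.invertibleOfIsUnitDet _ h2.ne'.isUnit
    rw [← Matrix.fromBlocks_one, Matrix.fromBlocks_add, zero_add, zero_add]
    rcases h with h | h
    · rw [Matrix.det_fromBlocks₁₁, Matrix.invOf_eq_nonsing_inv]
      exact mul_nonpos_of_nonneg_of_nonpos h1.le h
    · rw [Matrix.det_fromBlocks₂₂, Matrix.invOf_eq_nonsing_inv]
      exact mul_nonpos_of_nonneg_of_nonpos h2.le h
  exact ⟨hdet, fun hP => hdet.not_gt hP.det_pos⟩
end

section
/- Let G be a real N×N matrix with zero diagonal and nonnegative off-diagonal entries (a network game of strategic substitutes). Then for every q ∈ ℝ^N, the linear complementarity problem LCP(I+G, −q) has at least one solution; that is, the single-layer network game always has at least one Nash equilibrium. -/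
/-- `z` is a solution of the linear complementarity problem LCP(M, b). -/
def IsLCPSolution {m : Type*} [Fintype m] (M : Matrix m m ℝ) (b z : m → ℝ) : Prop :=
  (∀ i, 0 ≤ z i) ∧ (∀ i, 0 ≤ M.mulVec z i + b i) ∧ (∀ i, z i * (M.mulVec z i + b i) = 0)

open Filter Topology

section AffinePaths

variable {ι : Type*}

/-- The root of `t ↦ α i + β i * t` lies in the open interval `(s, t)`, and all the affine functions
`α j + β j * ·` are nonnegative there. -/
def IsFeasibleRoot (α β : ι → ℝ) (s t : ℝ) (i : ι) : Prop :=
  s < -α i / β i ∧ -α i / β i < t ∧ ∀ j, 0 ≤ α j + β j * (-α i / β i)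

theorem exists_isFeasibleRoot_pos [Finite ι] {α β : ι → ℝ} (hβ : ∀ i, β i ≠ 0) {s t r : ℝ}
    (hrt : r < t) (hsr : s < r) (hr : ∀ j, 0 ≤ α j + β j * r)
    (hs : ¬ ∀ j, 0 ≤ α j + β j * s) : ∃ i, 0 < β i ∧ IsFeasibleRoot α β s t i := by
  have hroot : ∀ i, α i + β i * (-α i / β i) = 0 := fun i => by field_simp [hβ i]; ring
  push Not at hs
  obtain ⟨j, hj⟩ := hs
  have hj' : 0 < β j := by nlinarith [hr j]
  obtain ⟨i, hi, hmax⟩ := Set.exists_max_image {i | 0 < β i} (fun i => -α i / β i)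
    (Set.toFinite _) ⟨j, hj'⟩
  simp only [Set.mem_ofPred_eq] at hi hmax
  have hir : -α i / β i ≤ r := by
    by_contra! h
    nlinarith [hr i, hroot i]
  refine ⟨i, hi, ?_, hir.trans_lt hrt, fun k => ?_⟩
  · refine lt_of_lt_of_le ?_ (hmax j hj')
    by_contra! h
    nlinarith [hroot j]
  · rcases lt_or_gt_of_ne (hβ k) with hk | hk
    · nlinarith [hr k]
    · nlinarith [hroot k, hmax k hk]

theorem isFeasibleRoot_neg {α β : ι → ℝ} {s t : ℝ} {i : ι} :
    IsFeasibleRoot α (-β) (-t) (-s) i ↔ IsFeasibleRoot α β s t i := by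
  simp only [IsFeasibleRoot, Pi.neg_apply, div_neg, neg_mul_neg, neg_lt_neg_iff]
  tauto

theorem exists_isFeasibleRoot_neg [Finite ι] {α β : ι → ℝ} (hβ : ∀ i, β i ≠ 0) {s t r : ℝ}
    (hrt : r < t) (hsr : s < r) (hr : ∀ j, 0 ≤ α j + β j * r)
    (ht : ¬ ∀ j, 0 ≤ α j + β j * t) : ∃ i, β i < 0 ∧ IsFeasibleRoot α β s t i := by
  obtain ⟨i, hi, h⟩ := exists_isFeasibleRoot_pos (α := α) (β := -β) (s := -t) (t := -s) (r := -r)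
    (fun i => neg_ne_zero.mpr (hβ i)) (neg_lt_neg hsr) (neg_lt_neg hrt)
    (by simpa using hr) (by simpa using ht)
  exact ⟨i, by simpa using hi, isFeasibleRoot_neg.mp h⟩

theorem IsFeasibleRoot.eq_of_mul_pos {α β : ι → ℝ} (hβ : ∀ i, β i ≠ 0)
    (hαβ : ∀ i j, i ≠ j → α i * β j ≠ α j * β i) {s t : ℝ} {i j : ι}
    (hi : IsFeasibleRoot α β s t i) (hj : IsFeasibleRoot α β s t j) (hij : 0 < β i * β j) :
    i = j := by
  by_contra hne
  have h1 := hi.2.2 j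
  have h2 := hj.2.2 i
  have e1 : β i * (α j + β j * (-α i / β i)) = α j * β i - α i * β j := by
    field_simp [hβ i]; ring
  have e2 : β j * (α i + β i * (-α j / β j)) = α i * β j - α j * β i := by
    field_simp [hβ j]; ring
  refine hαβ i j hne ?_
  rcases pos_and_pos_or_neg_and_neg_of_mul_pos hij with ⟨h, h'⟩ | ⟨h, h'⟩
  · have := mul_nonneg h.le h1
    have := mul_nonneg h'.le h2
    linarith
  · have := mul_nonpos_of_nonpos_of_nonneg h.le h1
    have := mul_nonpos_of_nonpos_of_nonneg h'.le h2
    linarith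

open Classical in
theorem sum_isFeasibleRoot_eq_zero [Fintype ι] {α β : ι → ℝ} (hβ : ∀ i, β i ≠ 0)
    (hαβ : ∀ i j, i ≠ j → α i * β j ≠ α j * β i) {s t : ℝ}
    (hs : ¬ ∀ j, 0 ≤ α j + β j * s) (ht : ¬ ∀ j, 0 ≤ α j + β j * t) :
    ∑ i, (if IsFeasibleRoot α β s t i then 1 else 0 : ZMod 2) = 0 := by
  by_cases hex : ∃ i, IsFeasibleRoot α β s t i
  · obtain ⟨k, hk⟩ := hex
    obtain ⟨i, hi, hi'⟩ := exists_isFeasibleRoot_pos hβ hk.2.1 hk.1 hk.2.2 hs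
    obtain ⟨j, hj, hj'⟩ := exists_isFeasibleRoot_neg hβ hk.2.1 hk.1 hk.2.2 ht
    have hij : i ≠ j := by rintro rfl; linarith
    have hfilter : Finset.univ.filter (IsFeasibleRoot α β s t) = {i, j} := by
      ext l
      simp only [Finset.mem_filter, Finset.mem_univ, true_and, Finset.mem_insert,
        Finset.mem_singleton]
      constructor
      · intro hl
        rcases lt_or_gt_of_ne (hβ l) with h | h
        · exact Or.inr (hl.eq_of_mul_pos hβ hαβ hj' (mul_pos_of_neg_of_neg h hj))
        · exact Or.inl (hl.eq_of_mul_pos hβ hαβ hi' (mul_pos h hi))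
      · rintro (rfl | rfl) <;> assumption
    rw [← Finset.sum_filter, hfilter, Finset.sum_pair hij]
    decide
  · push Not at hex
    simp [hex]

open Classical in
theorem sum_isFeasibleRoot_eq_one [Fintype ι] {α β : ι → ℝ} (hβ : ∀ i, β i < 0)
    (hαβ : ∀ i j, i ≠ j → α i * β j ≠ α j * β i) {s t : ℝ} (hst : s < t)
    (hs : ∀ j, 0 < α j + β j * s) (ht : ¬ ∀ j, 0 ≤ α j + β j * t) :
    ∑ i, (if IsFeasibleRoot α β s t i then 1 else 0 : ZMod 2) = 1 := by
  have hroot : ∀ i, α i + β i * (-α i / β i) = 0 := fun i => by field_simp [(hβ i).ne]; ring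
  obtain ⟨j, -, hj⟩ := exists_isFeasibleRoot_neg (s := s - 1) (r := s) (fun i => (hβ i).ne) hst
    (by linarith) (fun j => (hs j).le) ht
  have hj' : IsFeasibleRoot α β s t j := by
    refine ⟨?_, hj.2⟩
    by_contra! h
    nlinarith [hroot j, hs j, hβ j]
  have hfilter : Finset.univ.filter (IsFeasibleRoot α β s t) = {j} := by
    ext l
    simp only [Finset.mem_filter, Finset.mem_univ, true_and, Finset.mem_singleton]
    constructor
    · intro hl
      exact hl.eq_of_mul_pos (fun i => (hβ i).ne) hαβ hj' (mul_pos_of_neg_of_neg (hβ l) (hβ j))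
    · rintro rfl
      exact hj'
  rw [← Finset.sum_filter, hfilter, Finset.sum_singleton]

end AffinePaths

section Genericity

variable {ι n : Type*} [Finite ι] [Fintype n]

theorem dense_setOf_dotProduct_ne_zero (v : ι → n → ℝ) (hv : ∀ i, v i ≠ 0) :
    Dense {x : n → ℝ | ∀ i, v i ⬝ᵥ x ≠ 0} := by
  classical
  have hcont : ∀ i, Continuous fun x : n → ℝ => v i ⬝ᵥ x := fun i => by
    unfold dotProduct; fun_prop
  rw [Set.ofPred_forall]
  refine dense_iInter_of_isOpen (fun i => isOpen_ne_fun (hcont i) continuous_const) fun i => ?_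
  have hker : {x : n → ℝ | v i ⬝ᵥ x ≠ 0} =
      ((LinearMap.ker (dotProductBilin ℝ ℝ (v i)) : Submodule ℝ (n → ℝ)) : Set (n → ℝ))ᶜ := by
    ext x; simp
  rw [hker, ← interior_eq_empty_iff_dense_compl, ← Set.not_nonempty_iff_eq_empty]
  intro h
  have htop := Submodule.eq_top_of_nonempty_interior' _ h
  refine hv i (dotProduct_self_eq_zero.mp ?_)
  have : v i ∈ LinearMap.ker (dotProductBilin ℝ ℝ (v i)) := htop ▸ Submodule.mem_top
  simpa using this

end Genericity

section Complementary

open Matrix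

variable {n : Type*} [Fintype n] [DecidableEq n]

/-- The complementary matrix of `M` for the index set `S`: columns of `M` inside `S`, columns of
`-1` outside. -/
def complementaryMatrix (M : Matrix n n ℝ) (S : Finset n) : Matrix n n ℝ :=
  Matrix.of fun i j => if j ∈ S then M i j else -(1 : Matrix n n ℝ) i j

theorem complementaryMatrix_mulVec (M : Matrix n n ℝ) (S : Finset n) (y : n → ℝ) (i : n) :
    (complementaryMatrix M S *ᵥ y) i =
      (M *ᵥ fun j => if j ∈ S then y j else 0) i - if i ∈ S then 0 else y i := by
  have h : (if i ∈ S then 0 else y i) =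
      ∑ j, (1 : Matrix n n ℝ) i j * if j ∈ S then 0 else y j := by
    rw [Finset.sum_eq_single i (fun j _ hj => by simp [Matrix.one_apply_ne hj.symm]) (by simp)]
    simp
  rw [h]
  simp only [mulVec, dotProduct, complementaryMatrix, of_apply, ← Finset.sum_sub_distrib]
  refine Finset.sum_congr rfl fun j _ => ?_
  split_ifs <;> ring

theorem isLCPSolution_of_complementaryMatrix {M : Matrix n n ℝ} {S : Finset n} {y q : n → ℝ}
    (hy : ∀ i, 0 ≤ y i) (h : complementaryMatrix M S *ᵥ y = q) :
    IsLCPSolution M (-q) fun j => if j ∈ S then y j else 0 := by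
  have hw : ∀ i, (M *ᵥ fun j => if j ∈ S then y j else 0) i + (-q) i =
      if i ∈ S then 0 else y i := fun i => by
    rw [← h, Pi.neg_apply, complementaryMatrix_mulVec]; ring
  refine ⟨fun i => ?_, fun i => ?_, fun i => ?_⟩
  · dsimp only; split_ifs <;> simp [hy]
  · rw [hw]; split_ifs <;> simp [hy]
  · rw [hw]; by_cases hi : i ∈ S <;> simp [hi]

theorem complementaryMatrix_mulVec_congr {M : Matrix n n ℝ} {S T : Finset n} {y : n → ℝ}
    (h : ∀ j, y j ≠ 0 → (j ∈ S ↔ j ∈ T)) :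
    complementaryMatrix M S *ᵥ y = complementaryMatrix M T *ᵥ y := by
  ext i
  simp only [mulVec, dotProduct, complementaryMatrix, of_apply]
  refine Finset.sum_congr rfl fun j _ => ?_
  by_cases hj : y j = 0
  · simp [hj]
  · simp [h j hj]

theorem eq_empty_of_complementaryMatrix_mulVec_neg {M : Matrix n n ℝ} (hM : ∀ i j, 0 ≤ M i j)
    {S : Finset n} {y : n → ℝ} (hy : ∀ i, 0 ≤ y i)
    (h : ∀ i, (complementaryMatrix M S *ᵥ y) i < 0) : S = ∅ := by
  refine Finset.eq_empty_of_forall_notMem fun i hi => (h i).not_ge ?_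
  rw [complementaryMatrix_mulVec, if_pos hi, sub_zero]
  refine Finset.sum_nonneg fun j _ => mul_nonneg (hM i j) ?_
  dsimp only; split_ifs <;> simp [hy]

/-- Parity argument along the ray `q + t • d`: the roots of the complementary solutions are paired
by flipping the vanishing index. -/
theorem exists_isLCPSolution_of_generic [Nonempty n] {M : Matrix n n ℝ} (hM : ∀ i j, 0 ≤ M i j)
    (hdet : ∀ S, IsUnit (complementaryMatrix M S).det) {d q : n → ℝ} (hd : ∀ i, 0 < d i)
    (hβ : ∀ S i, ((complementaryMatrix M S)⁻¹ *ᵥ d) i ≠ 0)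
    (hαβ : ∀ S i j, i ≠ j →
      ((complementaryMatrix M S)⁻¹ *ᵥ q) i * ((complementaryMatrix M S)⁻¹ *ᵥ d) j ≠
        ((complementaryMatrix M S)⁻¹ *ᵥ q) j * ((complementaryMatrix M S)⁻¹ *ᵥ d) i) :
    ∃ z, IsLCPSolution M (-q) z := by
  classical
  by_contra hno
  set α : Finset n → n → ℝ := fun S => (complementaryMatrix M S)⁻¹ *ᵥ q with hα
  set β : Finset n → n → ℝ := fun S => (complementaryMatrix M S)⁻¹ *ᵥ d with hβ'
  have hsol : ∀ S t, complementaryMatrix M S *ᵥ (fun j => α S j + β S j * t) = q + t • d := by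
    intro S t
    have e : (fun j => α S j + β S j * t) = (complementaryMatrix M S)⁻¹ *ᵥ (q + t • d) := by
      ext j
      simp [hα, hβ', mulVec_add, mulVec_smul, mul_comm]
    rw [e, mulVec_mulVec, mul_nonsing_inv _ (hdet S), one_mulVec]
  have huniq : ∀ S t y, complementaryMatrix M S *ᵥ y = q + t • d →
      y = fun j => α S j + β S j * t := by
    intro S t y h
    rw [← hsol S t] at h
    exact mulVec_injective_of_isUnit ((isUnit_iff_isUnit_det _).mpr (hdet S)) h
  have hzero : ∀ S, ¬ ∀ j, 0 ≤ α S j + β S j * 0 := fun S h =>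
    hno ⟨_, isLCPSolution_of_complementaryMatrix h (by rw [hsol]; simp)⟩
  obtain ⟨s, hs0, hs⟩ : ∃ s : ℝ, s < 0 ∧ ∀ i, (q + s • d) i < 0 := by
    have hev : ∀ᶠ s : ℝ in atBot, s < 0 ∧ ∀ i, (q + s • d) i < 0 := by
      refine (eventually_lt_atBot 0).and (eventually_all.mpr fun i => ?_)
      have : Tendsto (fun s : ℝ => q i + s * d i) atBot atBot :=
        tendsto_atBot_add_const_left _ _ (tendsto_id.atBot_mul_const (hd i))
      simpa using this.eventually_lt_atBot 0
    exact hev.exists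
  have hempty : ∀ t, (fun j => α ∅ j + β ∅ j * t) = fun j => -(q j + t * d j) := by
    intro t
    refine (huniq ∅ t _ ?_).symm
    ext i
    rw [complementaryMatrix_mulVec]
    simp [mulVec, dotProduct]
  have hβe : ∀ i, β ∅ i < 0 := by
    intro i
    have h0 := congrFun (hempty 0) i
    have h1 := congrFun (hempty 1) i
    linarith [hd i]
  have hinv : ∀ S i, IsFeasibleRoot (α S) (β S) s 0 i →
      IsFeasibleRoot (α (symmDiff S {i})) (β (symmDiff S {i})) s 0 i := by
    intro S i h
    set τ := -α S i / β S i with hτ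
    have hi0 : α S i + β S i * τ = 0 := by rw [hτ, mul_div_cancel₀ _ (hβ S i), add_neg_cancel]
    have hy : (fun j => α S j + β S j * τ) =
        fun j => α (symmDiff S {i}) j + β (symmDiff S {i}) j * τ := by
      refine huniq _ _ _ ?_
      rw [← hsol S τ]
      refine (complementaryMatrix_mulVec_congr fun j hj => ?_).symm
      have hji : j ≠ i := fun e => hj (by simpa [e] using hi0)
      simp [Finset.mem_symmDiff, hji]
    have hτ' : -α (symmDiff S {i}) i / β (symmDiff S {i}) i = τ := by
      have := congrFun hy i
      rw [hi0] at this
      rw [div_eq_iff (hβ _ i)]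
      linarith
    refine ⟨hτ' ▸ h.1, hτ' ▸ h.2.1, fun j => ?_⟩
    rw [hτ', ← congrFun hy j]
    exact h.2.2 j
  have hsum : ∑ p : Finset n × n,
      (if IsFeasibleRoot (α p.1) (β p.1) s 0 p.2 then 1 else 0 : ZMod 2) = 0 := by
    refine Finset.sum_involution (fun p _ => (symmDiff p.1 {p.2}, p.2)) ?_ ?_ ?_ ?_
    · rintro ⟨S, i⟩ -
      have hiff : IsFeasibleRoot (α (symmDiff S {i})) (β (symmDiff S {i})) s 0 i ↔
          IsFeasibleRoot (α S) (β S) s 0 i :=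
        ⟨fun h => by simpa using hinv _ i h, hinv S i⟩
      simp only [hiff]
      exact CharTwo.add_self_eq_zero _
    · rintro ⟨S, i⟩ - - h
      simp at h
    · simp
    · rintro ⟨S, i⟩ -
      simp
  rw [Fintype.sum_prod_type, Finset.sum_eq_single ∅] at hsum
  · rw [sum_isFeasibleRoot_eq_one hβe (hαβ ∅) hs0 (fun j => ?_) (hzero ∅)] at hsum
    · exact one_ne_zero hsum
    · have := congrFun (hempty s) j
      rw [this]
      exact neg_pos.mpr (hs j)
  · intro S _ hS
    refine sum_isFeasibleRoot_eq_zero (hβ S) (hαβ S) (fun h => hS ?_) (hzero S)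
    exact eq_empty_of_complementaryMatrix_mulVec_neg hM h (by rwa [hsol])
  · simp

theorem dense_setOf_exists_isLCPSolution {M : Matrix n n ℝ} (hM : ∀ i j, 0 ≤ M i j)
    (hdet : ∀ S, IsUnit (complementaryMatrix M S).det) :
    Dense {q : n → ℝ | ∃ z, IsLCPSolution M (-q) z} := by
  rcases isEmpty_or_nonempty n with hn | hn
  · exact fun q => subset_closure ⟨0, fun i => hn.elim i, fun i => hn.elim i, fun i => hn.elim i⟩
  have hrow : ∀ S i, (complementaryMatrix M S)⁻¹ i ᵥ* complementaryMatrix M S = Pi.single i 1 := by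
    intro S i
    ext j
    have := congrFun (congrFun (nonsing_inv_mul _ (hdet S)) i) j
    rw [one_apply, mul_apply] at this
    rw [vecMul, dotProduct, this, Pi.single_apply]
    simp [eq_comm]
  obtain ⟨d, hd, hβ⟩ : ∃ d : n → ℝ, (∀ i, 0 < d i) ∧
      ∀ S i, ((complementaryMatrix M S)⁻¹ *ᵥ d) i ≠ 0 := by
    have hdense := dense_setOf_dotProduct_ne_zero
      (fun p : Finset n × n => (complementaryMatrix M p.1)⁻¹ p.2) (fun p h => by
        have := hrow p.1 p.2
        rw [h, zero_vecMul] at this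
        simpa using congrFun this p.2)
    have hopen : IsOpen {d : n → ℝ | ∀ i, 0 < d i} := by
      rw [Set.ofPred_forall]
      exact isOpen_iInter_of_finite fun i => isOpen_lt continuous_const (continuous_apply i)
    obtain ⟨d, hd, hd'⟩ := hdense.inter_open_nonempty _ hopen ⟨1, fun i => one_pos⟩
    exact ⟨d, hd, fun S i => hd' (S, i)⟩
  refine (dense_setOf_dotProduct_ne_zero
    (fun p : Finset n × {p : n × n // p.1 ≠ p.2} =>
      ((complementaryMatrix M p.1)⁻¹ *ᵥ d) p.2.1.2 • (complementaryMatrix M p.1)⁻¹ p.2.1.1 -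
        ((complementaryMatrix M p.1)⁻¹ *ᵥ d) p.2.1.1 • (complementaryMatrix M p.1)⁻¹ p.2.1.2)
    ?_).mono ?_
  · rintro ⟨S, ⟨i, j⟩, hij⟩ h
    have h2 := congrArg (fun v => (v ᵥ* complementaryMatrix M S) i) h
    simp only [sub_vecMul, smul_vecMul, hrow, zero_vecMul] at h2
    simp only [Pi.sub_apply, Pi.smul_apply, Pi.single_eq_same, Pi.single_eq_of_ne hij,
      smul_eq_mul, mul_one, mul_zero, sub_zero, Pi.zero_apply] at h2
    exact hβ S j h2
  · intro q hq
    refine exists_isLCPSolution_of_generic hM hdet hd hβ fun S i j hij h => ?_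
    refine hq (S, ⟨(i, j), hij⟩) ?_
    rw [sub_dotProduct, smul_dotProduct, smul_dotProduct, sub_eq_zero, smul_eq_mul, smul_eq_mul,
      mul_comm, mul_comm (((complementaryMatrix M S)⁻¹ *ᵥ d) i)]
    exact h

theorem eventually_isUnit_det_complementaryMatrix (A : Matrix n n ℝ) (c : ℝ) :
    ∀ᶠ x in 𝓝[>] c, ∀ S, IsUnit (complementaryMatrix (x • 1 + A) S).det := by
  refine eventually_all.mpr fun S => ?_
  set H : Matrix n n ℝ := of fun i j => if i ∈ S ∧ j ∈ S then A i j else 0 with hH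
  have hfin : {x : ℝ | H.charpoly.eval (-x) = 0}.Finite := by
    have := (H.charpoly.rootSet_finite ℝ).preimage (f := fun x : ℝ => -x) neg_injective.injOn
    refine this.subset fun x hx => ?_
    simpa [Polynomial.mem_rootSet, H.charpoly_monic.ne_zero] using hx
  have hev : ∀ᶠ x in 𝓝[>] c, H.charpoly.eval (-x) ≠ 0 := by
    filter_upwards [(hfin.eventually_cofinite_notMem.filter_mono
      ((nhdsGT_le_nhdsNE c).trans (nhdsNE_le_cofinite c)))] with x hx using hx
  filter_upwards [hev] with x hx
  rw [isUnit_iff_ne_zero]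
  contrapose! hx
  obtain ⟨v, hv0, hv⟩ := exists_mulVec_eq_zero_iff.mpr hx
  rw [eval_charpoly]
  have hv' := fun i => (complementaryMatrix_mulVec (x • 1 + A) S v i).symm.trans (congrFun hv i)
  set u : n → ℝ := fun j => if j ∈ S then v j else 0 with hu
  refine exists_mulVec_eq_zero_iff.mp ⟨u, fun hu0 => hv0 ?_, ?_⟩
  · ext i
    have h1 := hv' i
    have h2 := congrFun hu0 i
    by_cases hi : i ∈ S
    · simpa [hu, hi] using h2
    · rw [hu0, mulVec_zero] at h1
      simpa [hi] using h1
  · ext i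
    have hHu : (H *ᵥ u) i = if i ∈ S then (A *ᵥ u) i else 0 := by
      split_ifs with hi
      · refine Finset.sum_congr rfl fun j _ => ?_
        by_cases hj : j ∈ S <;> simp [hH, hu, hi, hj]
      · refine Finset.sum_eq_zero fun j _ => ?_
        simp [hH, hi]
    have hscal : (scalar n (-x) *ᵥ u) i = -x * u i := by
      simp [scalar_apply, mulVec_diagonal]
    rw [sub_mulVec, Pi.sub_apply, hHu, hscal, Pi.zero_apply]
    split_ifs with hi
    · have h1 := hv' i
      simp only [add_mulVec, smul_mulVec, one_mulVec, Pi.add_apply, Pi.smul_apply, smul_eq_mul,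
        hi, if_true, Pi.zero_apply] at h1
      linarith
    · simp [hu, hi]

end Complementary

open Matrix in
theorem IsLCPSolution.le_of_one_le {n : Type*} [Fintype n] [DecidableEq n] {A : Matrix n n ℝ}
    (hA : ∀ i j, 0 ≤ A i j) {x : ℝ} (hx : 1 ≤ x) {q z : n → ℝ}
    (h : IsLCPSolution (x • 1 + A) (-q) z) (i : n) : z i ≤ max (q i) 0 := by
  obtain ⟨hz, -, hc⟩ := h
  rcases (hz i).eq_or_lt with h0 | h0
  · rw [← h0]; exact le_max_right _ _
  · refine le_max_of_le_left ?_
    have h1 := (mul_eq_zero.mp (hc i)).resolve_left h0.ne'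
    have h2 : 0 ≤ (A *ᵥ z) i := Finset.sum_nonneg fun j _ => mul_nonneg (hA i j) (hz j)
    simp only [add_mulVec, smul_mulVec, one_mulVec, Pi.add_apply, Pi.smul_apply, smul_eq_mul,
      Pi.neg_apply] at h1
    nlinarith

open Matrix in
theorem exists_isLCPSolution_one_add {n : Type*} [Fintype n] [DecidableEq n] {A : Matrix n n ℝ}
    (hA : ∀ i j, 0 ≤ A i j) (q : n → ℝ) : ∃ z, IsLCPSolution (1 + A) (-q) z := by
  have happrox : ∀ k : ℕ, ∃ (x : ℝ) (p z : n → ℝ), 1 ≤ x ∧ dist x 1 < 1 / ((k : ℝ) + 1) ∧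
      dist p q < 1 / ((k : ℝ) + 1) ∧ IsLCPSolution (x • 1 + A) (-p) z := by
    intro k
    have hk : 0 < 1 / ((k : ℝ) + 1) := Nat.one_div_pos_of_nat
    obtain ⟨x, ⟨hdet, hx1⟩, hx⟩ := (((eventually_isUnit_det_complementaryMatrix A 1).and
      self_mem_nhdsWithin).and (mem_nhdsWithin_of_mem_nhds (Metric.ball_mem_nhds 1 hk))).exists
    have hM : ∀ i j, 0 ≤ (x • 1 + A : Matrix n n ℝ) i j := fun i j => by
      have : 0 ≤ x * (1 : Matrix n n ℝ) i j :=
        mul_nonneg (zero_le_one.trans (le_of_lt hx1)) (by rw [one_apply]; split_ifs <;> simp)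
      simpa using add_nonneg this (hA i j)
    obtain ⟨p, ⟨z, hz⟩, hp⟩ := (dense_setOf_exists_isLCPSolution hM hdet).exists_dist_lt q hk
    exact ⟨x, p, z, le_of_lt hx1, hx, by rwa [dist_comm], hz⟩
  choose x p z hx1 hx hp hz using happrox
  have hxlim : Tendsto x atTop (𝓝 1) := tendsto_iff_dist_tendsto_zero.mpr
    (squeeze_zero (fun _ => dist_nonneg) (fun k => (hx k).le) tendsto_one_div_add_atTop_nhds_zero_nat)
  have hplim : Tendsto p atTop (𝓝 q) := tendsto_iff_dist_tendsto_zero.mpr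
    (squeeze_zero (fun _ => dist_nonneg) (fun k => (hp k).le) tendsto_one_div_add_atTop_nhds_zero_nat)
  have hmem : ∀ k, z k ∈ Set.Icc (0 : n → ℝ) fun i => max (q i + 1) 0 := by
    refine fun k => ⟨(hz k).1, fun i => ((hz k).le_of_one_le hA (hx1 k) i).trans ?_⟩
    refine max_le_max_right _ ?_
    have h1 : |p k i - q i| ≤ dist (p k) q := dist_le_pi_dist (p k) q i
    have h2 : 1 / ((k : ℝ) + 1) ≤ 1 := by
      rw [div_le_one (by positivity)]
      linarith [Nat.cast_nonneg (α := ℝ) k]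
    linarith [(abs_le.mp h1).2, hp k]
  obtain ⟨y, -, φ, hφ, hy⟩ := isCompact_Icc.tendsto_subseq hmem
  have hyi := tendsto_pi_nhds.mp hy
  have hw : ∀ i, Tendsto (fun k => ((x (φ k) • 1 + A) *ᵥ z (φ k)) i + (-p (φ k)) i) atTop
      (𝓝 (((1 + A) *ᵥ y) i + (-q) i)) := by
    intro i
    have h1 := (hxlim.comp hφ.tendsto_atTop).mul (hyi i)
    have h2 : Tendsto (fun k => (A *ᵥ z (φ k)) i) atTop (𝓝 ((A *ᵥ y) i)) :=
      tendsto_finsetSum _ fun j _ => (hyi j).const_mul (A i j)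
    have h3 := (tendsto_pi_nhds.mp (hplim.comp hφ.tendsto_atTop) i).neg
    simpa [add_mulVec, smul_mulVec] using (h1.add h2).add h3
  refine ⟨y, fun i => ?_, fun i => ?_, fun i => ?_⟩
  · exact ge_of_tendsto' (hyi i) fun k => (hz (φ k)).1 i
  · exact ge_of_tendsto' (hw i) fun k => (hz (φ k)).2.1 i
  · refine tendsto_nhds_unique ((hyi i).mul (hw i)) ?_
    exact tendsto_const_nhds.congr fun k => ((hz (φ k)).2.2 i).symm

/-- A network game of strategic substitutes (zero diagonal, nonnegative
off-diagonal entries) always has at least one Nash equilibrium: LCP(I+G, −q) is solvable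
for every `q`. -/
theorem substitutes_LCP_solution_exists {N : ℕ} (G : Matrix (Fin N) (Fin N) ℝ)
    (hd : ∀ i, G i i = 0) (hoff : ∀ i j, i ≠ j → 0 ≤ G i j) :
    ∀ q : Fin N → ℝ, ∃ z : Fin N → ℝ, IsLCPSolution (1 + G) (-q) z := by
  refine exists_isLCPSolution_one_add fun i j => ?_
  rcases eq_or_ne i j with rfl | h
  · exact (hd i).ge
  · exact hoff i j h
end

section
/- Let G be a real N×N matrix with zero diagonal and nonpositive off-diagonal entries (a network game of strategic complements). Then the linear complementarity problem LCP(I+G, −q) has a unique solution for every q ∈ ℝ^N if and only if the spectral radius ρ(G) < 1. -/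
open scoped ENNReal

/-- The spectral radius of a real matrix: the maximum modulus of its complex eigenvalues. -/
noncomputable def specRad {m : Type*} [Fintype m] [DecidableEq m] (A : Matrix m m ℝ) : ℝ≥0∞ :=
  spectralRadius ℂ (A.map (algebraMap ℝ ℂ))

open Matrix

theorem Matrix.mulVec_mono_of_nonneg {m : Type*} [Fintype m] {A : Matrix m m ℝ}
    (hA : ∀ i j, 0 ≤ A i j) {x y : m → ℝ}
    (h : x ≤ y) : A *ᵥ x ≤ A *ᵥ y := fun i =>
  Finset.sum_le_sum fun j _ => mul_le_mul_of_nonneg_left (h j) (hA i j)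

theorem Matrix.mulVec_nonneg_of_nonneg {m : Type*} [Fintype m] {A : Matrix m m ℝ}
    (hA : ∀ i j, 0 ≤ A i j) {x : m → ℝ} (h : 0 ≤ x) : 0 ≤ A *ᵥ x := by
  simpa only [mulVec_zero] using mulVec_mono_of_nonneg hA h

/-- A nonnegative matrix with a positive strictly superharmonic vector has no subharmonic vector
with a positive entry. -/
theorem Matrix.nonpos_of_le_mulVec {m : Type*} [Fintype m] {A : Matrix m m ℝ}
    (hA : ∀ i j, 0 ≤ A i j) {u d : m → ℝ}
    (hu : ∀ i, 0 < u i) (hAu : ∀ i, (A *ᵥ u) i < u i) (hd : d ≤ A *ᵥ d) : d ≤ 0 := by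
  intro k
  obtain ⟨i, -, hi⟩ :=
    Finset.exists_max_image Finset.univ (fun i => d i / u i) ⟨k, Finset.mem_univ k⟩
  set c := d i / u i
  have hle : d ≤ c • u := fun j => (div_le_iff₀ (hu j)).mp (hi j (Finset.mem_univ j))
  have hc0 : c ≤ 0 := by
    by_contra! hpos
    have h₁ : d i ≤ c * (A *ᵥ u) i := by
      simpa [mulVec_smul] using (hd i).trans (mulVec_mono_of_nonneg hA hle i)
    have h₂ : c * (A *ᵥ u) i < c * u i := mul_lt_mul_of_pos_left (hAu i) hpos
    have h₃ : c * u i = d i := div_mul_cancel₀ _ (hu i).ne'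
    linarith
  exact (hle k).trans (mul_nonpos_of_nonpos_of_nonneg hc0 (hu k).le)

theorem isLCPSolution_one_add_iff {m : Type*} [Fintype m] [DecidableEq m] (G : Matrix m m ℝ)
    (q z : m → ℝ) :
    IsLCPSolution (1 + G) (-q) z ↔ ∀ i, z i = max 0 ((-G *ᵥ z) i + q i) := by
  simp only [IsLCPSolution, ← forall_and, add_mulVec, one_mulVec, neg_mulVec, Pi.add_apply,
    Pi.neg_apply]
  refine forall_congr' fun i => ⟨?_, fun h => ?_⟩
  · rintro ⟨h₁, h₂, h₃⟩
    rcases mul_eq_zero.mp h₃ with h | h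
    · rw [max_eq_left] <;> linarith
    · rw [max_eq_right] <;> linarith
  · have h₁ : 0 ≤ z i := h ▸ le_max_left _ _
    have h₂ : -(G *ᵥ z) i + q i ≤ z i := h.symm ▸ le_max_right _ _
    refine ⟨h₁, by linarith, mul_eq_zero.mpr ?_⟩
    rcases max_choice 0 (-(G *ᵥ z) i + q i) with h' | h' <;> rw [h'] at h
    · exact .inl h
    · right; linarith

theorem specRad_lt_one_of_mulVec_lt {m : Type*} [Fintype m] [DecidableEq m] {G : Matrix m m ℝ}
    (hG : ∀ i j, G i j ≤ 0)
    {u : m → ℝ} (hu : ∀ i, 0 < u i) (hGu : ∀ i, (-G *ᵥ u) i < u i) : specRad G < 1 := by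
  have hlt : ∀ μ ∈ spectrum ℂ (G.map (algebraMap ℝ ℂ)), (‖μ‖₊ : ℝ≥0∞) < 1 := by
    intro μ hμ
    rw [← Matrix.spectrum_toLin', ← Module.End.hasEigenvalue_iff_mem_spectrum] at hμ
    obtain ⟨v, hv⟩ := hμ.exists_hasEigenvector
    by_contra! hge
    have hge : 1 ≤ ‖μ‖ := by exact_mod_cast hge
    refine hv.2 (funext fun i => norm_le_zero_iff.mp ?_)
    refine Matrix.nonpos_of_le_mulVec (A := -G) (d := fun i => ‖v i‖)
      (fun i j => neg_nonneg.mpr (hG i j)) hu hGu (fun i => ?_) i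
    have hev : ∑ j, (G i j : ℂ) * v j = μ * v i := congrFun hv.apply_eq_smul i
    calc ‖v i‖ ≤ ‖μ‖ * ‖v i‖ := le_mul_of_one_le_left (norm_nonneg _) hge
      _ = ‖∑ j, (G i j : ℂ) * v j‖ := by rw [hev, norm_mul]
      _ ≤ ∑ j, ‖(G i j : ℂ) * v j‖ := norm_sum_le _ _
      _ = (-G *ᵥ fun i => ‖v i‖) i := Finset.sum_congr rfl fun j _ => by
          rw [norm_mul, Complex.norm_real, Real.norm_of_nonpos (hG i j)]
          rfl
  have hfin := Matrix.finite_spectrum (G.map (algebraMap ℝ ℂ))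
  rw [specRad, spectralRadius, ← hfin.coe_toFinset]
  simp only [Finset.mem_coe, ← Finset.sup_eq_iSup]
  exact (Finset.sup_lt_iff zero_lt_one).mpr fun μ hμ => hlt μ (hfin.mem_toFinset.mp hμ)

attribute [local instance] Matrix.linftyOpNormedRing Matrix.linftyOpNormedAlgebra in
theorem exists_pow_sum_abs_lt_one_of_specRad_lt_one {m : Type*} [Fintype m] [DecidableEq m]
    {G : Matrix m m ℝ}
    (h : specRad G < 1) : ∃ n, n ≠ 0 ∧ ∀ i, ∑ j, |(G ^ n) i j| < 1 := by
  obtain ⟨n, hn, hn0⟩ := (((spectrum.pow_nnnorm_pow_one_div_tendsto_nhds_spectralRadius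
    (G.map (algebraMap ℝ ℂ))).eventually_lt_const h).and (Filter.eventually_ne_atTop 0)).exists
  refine ⟨n, hn0, fun i => ?_⟩
  have hlt : ‖G.map (algebraMap ℝ ℂ) ^ n‖₊ < 1 := by
    by_contra! hge
    exact hn.not_ge (ENNReal.one_le_rpow (by exact_mod_cast hge) (by positivity))
  rw [← Matrix.map_pow, linfty_opNNNorm_def, Finset.sup_lt_iff zero_lt_one] at hlt
  have := NNReal.coe_lt_coe.mpr (hlt i (Finset.mem_univ i))
  simpa using this

theorem exists_pos_mulVec_lt_of_specRad_lt_one {m : Type*} [Fintype m] [DecidableEq m]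
    {G : Matrix m m ℝ}
    (hG : ∀ i j, G i j ≤ 0) (h : specRad G < 1) :
    ∃ u : m → ℝ, (∀ i, 0 < u i) ∧ ∀ i, (-G *ᵥ u) i < u i := by
  obtain ⟨n, hn0, hn⟩ := exists_pow_sum_abs_lt_one_of_specRad_lt_one h
  have hpow : ∀ k : ℕ, 0 ≤ ((-G) ^ k) *ᵥ (1 : m → ℝ) := by
    intro k
    induction k with
    | zero => simp
    | succ k ih =>
      rw [pow_succ', ← mulVec_mulVec]
      exact mulVec_nonneg_of_nonneg (fun i j => neg_nonneg.mpr (hG i j)) ih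
  have hlt : ∀ i, (((-G) ^ n) *ᵥ (1 : m → ℝ)) i < 1 := by
    intro i
    refine lt_of_le_of_lt ?_ (hn i)
    refine Finset.sum_le_sum fun j _ => ?_
    rcases n.even_or_odd with hp | hp
    · simpa [hp.neg_pow] using le_abs_self _
    · simpa [hp.neg_pow] using neg_le_abs _
  refine ⟨∑ k ∈ Finset.range n, ((-G) ^ k) *ᵥ (1 : m → ℝ), fun i => ?_, fun i => ?_⟩
  · rw [Finset.sum_apply]
    refine Finset.sum_pos' (fun k _ => hpow k i) ⟨0, by simpa [Nat.pos_iff_ne_zero] using hn0, ?_⟩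
    simp
  · have key : -G *ᵥ ∑ k ∈ Finset.range n, ((-G) ^ k) *ᵥ (1 : m → ℝ) + 1 =
        ∑ k ∈ Finset.range n, ((-G) ^ k) *ᵥ (1 : m → ℝ) + ((-G) ^ n) *ᵥ (1 : m → ℝ) := by
      rw [← Finset.sum_range_succ, Finset.sum_range_succ', mulVec_sum]
      simp [pow_succ', mulVec_mulVec]
    have := congrFun key i
    have := hlt i
    simp only [Pi.add_apply, Pi.one_apply] at *
    linarith

theorem exists_eq_max_mulVec_add {m : Type*} [Fintype m] {A : Matrix m m ℝ} (hA : ∀ i j, 0 ≤ A i j)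
    {u : m → ℝ}
    (hu : ∀ i, 0 < u i) (hAu : ∀ i, (A *ᵥ u) i < u i) (q : m → ℝ) :
    ∃ z : m → ℝ, ∀ i, z i = max 0 ((A *ᵥ z) i + q i) := by
  obtain ⟨C, hC0, hC⟩ : ∃ C : ℝ, 0 ≤ C ∧ ∀ i, q i ≤ C * (u i - (A *ᵥ u) i) := by
    refine ⟨∑ i, |q i| / (u i - (A *ᵥ u) i), ?_, fun i => ?_⟩
    · exact Finset.sum_nonneg fun i _ => div_nonneg (abs_nonneg _) (sub_pos.mpr (hAu i)).le
    · rw [← div_le_iff₀ (sub_pos.mpr (hAu i))]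
      refine (div_le_div_of_nonneg_right (le_abs_self _) (sub_pos.mpr (hAu i)).le).trans ?_
      exact Finset.single_le_sum
        (f := fun i => |q i| / (u i - (A *ᵥ u) i))
        (fun i _ => div_nonneg (abs_nonneg _) (sub_pos.mpr (hAu i)).le) (Finset.mem_univ i)
  have hCu : (0 : m → ℝ) ≤ C • u := fun i => mul_nonneg hC0 (hu i).le
  let F : Set.Icc (0 : m → ℝ) (C • u) →o Set.Icc (0 : m → ℝ) (C • u) :=
    { toFun := fun z => ⟨fun i => max 0 ((A *ᵥ z) i + q i), fun i => le_max_left _ _, fun i => by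
        refine max_le (hCu i) ?_
        have h₁ := mulVec_mono_of_nonneg hA z.2.2 i
        have h₂ := hC i
        simp only [mulVec_smul, Pi.smul_apply, smul_eq_mul] at h₁ ⊢
        linarith⟩
      monotone' := fun z w hzw i =>
        max_le_max le_rfl (by gcongr; exact mulVec_mono_of_nonneg hA hzw i) }
  let : Fact ((0 : m → ℝ) ≤ C • u) := ⟨hCu⟩
  let : CompleteLattice (Set.Icc (0 : m → ℝ) (C • u)) := Set.Icc.completeLattice
  have hfix : F F.lfp = F.lfp := F.map_lfp
  exact ⟨F.lfp, fun i => (congrFun (congrArg Subtype.val hfix) i).symm⟩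

theorem eq_of_eq_max_mulVec_add {m : Type*} [Fintype m] {A : Matrix m m ℝ} (hA : ∀ i j, 0 ≤ A i j)
    {u : m → ℝ}
    (hu : ∀ i, 0 < u i) (hAu : ∀ i, (A *ᵥ u) i < u i) {q z w : m → ℝ}
    (hz : ∀ i, z i = max 0 ((A *ᵥ z) i + q i)) (hw : ∀ i, w i = max 0 ((A *ᵥ w) i + q i)) :
    z = w := by
  have hle : ∀ {z w : m → ℝ}, (∀ i, z i = max 0 ((A *ᵥ z) i + q i)) →
      (∀ i, w i = max 0 ((A *ᵥ w) i + q i)) → z ≤ w := by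
    intro z w hz hw
    have hd : (z - w) ⊔ 0 ≤ A *ᵥ ((z - w) ⊔ 0) := by
      refine sup_le (fun i => ?_) ?_
      · have h₁ := mulVec_mono_of_nonneg hA (le_sup_left : z - w ≤ (z - w) ⊔ 0) i
        have h₀ := mulVec_nonneg_of_nonneg hA (le_sup_right : 0 ≤ (z - w) ⊔ 0) i
        rw [mulVec_sub, Pi.sub_apply] at h₁
        rw [Pi.zero_apply] at h₀
        have h₂ : (A *ᵥ w) i + q i ≤ w i := (hw i).symm ▸ le_max_right _ _
        have h₃ : 0 ≤ w i := (hw i).symm ▸ le_max_left _ _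
        rw [Pi.sub_apply, sub_le_iff_le_add, hz i]
        exact max_le (by linarith) (by linarith)
      · exact mulVec_nonneg_of_nonneg hA (le_sup_right : 0 ≤ (z - w) ⊔ 0)
    exact sub_nonpos.mp (le_sup_left.trans (nonpos_of_le_mulVec hA hu hAu hd))
  exact le_antisymm (hle hz hw) (hle hw hz)

/-- For a network game of strategic complements (zero diagonal,
nonpositive off-diagonal entries), LCP(I+G, −q) has a unique solution for every `q`
iff the spectral radius of `G` is less than 1. -/
theorem complements_unique_LCP_iff_specRad_lt_one {N : ℕ} (G : Matrix (Fin N) (Fin N) ℝ)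
    (hd : ∀ i, G i i = 0) (hoff : ∀ i j, i ≠ j → G i j ≤ 0) :
    (∀ q : Fin N → ℝ, ∃! z : Fin N → ℝ, IsLCPSolution (1 + G) (-q) z) ↔
      specRad G < 1 := by
  have hG : ∀ i j, G i j ≤ 0 := fun i j => by
    rcases eq_or_ne i j with rfl | hij
    · exact (hd i).le
    · exact hoff i j hij
  have hA : ∀ i j, 0 ≤ (-G) i j := fun i j => neg_nonneg.mpr (hG i j)
  simp only [isLCPSolution_one_add_iff]
  constructor
  · intro h
    obtain ⟨z, hz, -⟩ := h 1
    have hz0 : 0 ≤ z := fun i => (hz i).symm ▸ le_max_left _ _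
    have hAz : ∀ i, (-G *ᵥ z) i + 1 ≤ z i := fun i => (hz i).symm ▸ le_max_right _ _
    have hAz0 : ∀ i, 0 ≤ (-G *ᵥ z) i := mulVec_nonneg_of_nonneg hA hz0
    exact specRad_lt_one_of_mulVec_lt hG (u := z) (fun i => by linarith [hAz i, hAz0 i])
      (fun i => by linarith [hAz i])
  · intro h q
    obtain ⟨u, hu, hAu⟩ := exists_pos_mulVec_lt_of_specRad_lt_one hG h
    obtain ⟨z, hz⟩ := exists_eq_max_mulVec_add hA hu hAu q
    exact ⟨z, hz, fun w hw => eq_of_eq_max_mulVec_add hA hu hAu hw hz⟩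
end

section
/- Let G¹ and G² be real symmetric N×N matrices with zero diagonal and let κ ∈ [0,1]. If |κ·λ_max(G¹) + (1−κ)·λ_min(G²)| ≥ 1, or |κ·λ_min(G¹) + (1−κ)·λ_max(G²)| ≥ 1, then ρ(κ·G¹ + (1−κ)·G²) ≥ 1; consequently, if the multiplex is a game of strategic complements, it has no Nash equilibrium. -/
open scoped ENNReal

/-- The smallest eigenvalue of a real symmetric (Hermitian) matrix. -/
noncomputable def eigMin {m : Type*} [Fintype m] [DecidableEq m] {A : Matrix m m ℝ}
    (hA : A.IsHermitian) : ℝ := ⨅ i, hA.eigenvalues i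

/-- The largest eigenvalue of a real symmetric (Hermitian) matrix. -/
noncomputable def eigMax {m : Type*} [Fintype m] [DecidableEq m] {A : Matrix m m ℝ}
    (hA : A.IsHermitian) : ℝ := ⨆ i, hA.eigenvalues i

namespace Matrix

open scoped RealInnerProductSpace

variable {m : Type*} [Fintype m] [DecidableEq m] {A : Matrix m m ℝ}

namespace IsHermitian

theorem toEuclideanLin_eigenvectorBasis (hA : A.IsHermitian) (i : m) :
    A.toEuclideanLin (hA.eigenvectorBasis i) = hA.eigenvalues i • hA.eigenvectorBasis i := by
  ext j
  simpa [toLpLin_apply] using congrFun (hA.mulVec_eigenvectorBasis i) j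

theorem inner_toEuclideanLin_eigenvectorBasis (hA : A.IsHermitian) (i : m) :
    ⟪hA.eigenvectorBasis i, A.toEuclideanLin (hA.eigenvectorBasis i)⟫ = hA.eigenvalues i := by
  rw [hA.toEuclideanLin_eigenvectorBasis, real_inner_smul_right,
    real_inner_self_eq_norm_sq, hA.eigenvectorBasis.norm_eq_one]
  simp

theorem inner_toEuclideanLin_eq_sum (hA : A.IsHermitian) (v : EuclideanSpace ℝ m) :
    ⟪v, A.toEuclideanLin v⟫ = ∑ i, hA.eigenvalues i * ⟪hA.eigenvectorBasis i, v⟫ ^ 2 := by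
  rw [← hA.eigenvectorBasis.sum_inner_mul_inner]
  refine Finset.sum_congr rfl fun i _ ↦ ?_
  rw [← isSymmetric_toEuclideanLin_iff.mpr hA, hA.toEuclideanLin_eigenvectorBasis,
    real_inner_smul_left, real_inner_comm]
  ring

theorem inner_toEuclideanLin_le (hA : A.IsHermitian) {v : EuclideanSpace ℝ m} (hv : ‖v‖ = 1) :
    ⟪v, A.toEuclideanLin v⟫ ≤ eigMax hA := by
  rw [hA.inner_toEuclideanLin_eq_sum]
  calc
    _ ≤ ∑ i, eigMax hA * ⟪hA.eigenvectorBasis i, v⟫ ^ 2 := by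
      gcongr with i
      exact le_ciSup (Set.finite_range hA.eigenvalues).bddAbove i
    _ = eigMax hA := by
      rw [← Finset.mul_sum, hA.eigenvectorBasis.sum_sq_inner_right, hv]
      simp

theorem le_inner_toEuclideanLin (hA : A.IsHermitian) {v : EuclideanSpace ℝ m} (hv : ‖v‖ = 1) :
    eigMin hA ≤ ⟪v, A.toEuclideanLin v⟫ := by
  rw [hA.inner_toEuclideanLin_eq_sum]
  calc
    eigMin hA = ∑ i, eigMin hA * ⟪hA.eigenvectorBasis i, v⟫ ^ 2 := by
      rw [← Finset.mul_sum, hA.eigenvectorBasis.sum_sq_inner_right, hv]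
      simp
    _ ≤ _ := by
      gcongr with i
      exact ciInf_le (Set.finite_range hA.eigenvalues).bddBelow i

theorem exists_inner_eq_eigMax [Nonempty m] (hA : A.IsHermitian) :
    ∃ v : EuclideanSpace ℝ m, ‖v‖ = 1 ∧ ⟪v, A.toEuclideanLin v⟫ = eigMax hA := by
  obtain ⟨i, hi⟩ := exists_eq_ciSup_of_finite (f := hA.eigenvalues)
  exact ⟨_, hA.eigenvectorBasis.norm_eq_one i,
    (hA.inner_toEuclideanLin_eigenvectorBasis i).trans hi⟩

theorem exists_inner_eq_eigMin [Nonempty m] (hA : A.IsHermitian) :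
    ∃ v : EuclideanSpace ℝ m, ‖v‖ = 1 ∧ ⟪v, A.toEuclideanLin v⟫ = eigMin hA := by
  obtain ⟨i, hi⟩ := exists_eq_ciInf_of_finite (f := hA.eigenvalues)
  exact ⟨_, hA.eigenvectorBasis.norm_eq_one i,
    (hA.inner_toEuclideanLin_eigenvectorBasis i).trans hi⟩

theorem one_le_specRad (hA : A.IsHermitian) {i : m} (hi : 1 ≤ |hA.eigenvalues i|) :
    1 ≤ specRad A := by
  have hmem : (algebraMap ℝ ℂ) (hA.eigenvalues i) ∈ spectrum ℂ (A.map (algebraMap ℝ ℂ)) := by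
    rw [mem_spectrum_iff_isRoot_charpoly, charpoly_map]
    exact (mem_spectrum_iff_isRoot_charpoly.mp (hA.eigenvalues_mem_spectrum_real i)).map
  refine le_trans ?_ (le_iSup₂ (f := fun k (_ : k ∈ spectrum ℂ _) ↦ (‖k‖₊ : ℝ≥0∞)) _ hmem)
  rw [ENNReal.one_le_coe_iff, ← NNReal.coe_le_coe]
  simpa using hi

theorem one_le_specRad_of_mem_Icc [Nonempty m] (hA : A.IsHermitian) {c : ℝ} (hc : 1 ≤ |c|)
    (hmem : c ∈ Set.Icc (eigMin hA) (eigMax hA)) : 1 ≤ specRad A := by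
  rcases le_abs.mp hc with h | h
  · obtain ⟨i, hi⟩ := exists_eq_ciSup_of_finite (f := hA.eigenvalues)
    exact hA.one_le_specRad (le_abs.mpr (.inl (h.trans (hmem.2.trans_eq hi.symm))))
  · obtain ⟨i, hi⟩ := exists_eq_ciInf_of_finite (f := hA.eigenvalues)
    have : hA.eigenvalues i ≤ c := hi.trans_le hmem.1
    exact hA.one_le_specRad (le_abs.mpr (.inr (by linarith)))

theorem add_eigMax_eigMin_mem_Icc [Nonempty m] {B : Matrix m m ℝ} (hA : A.IsHermitian)
    (hB : B.IsHermitian) {a b : ℝ} (ha : 0 ≤ a) (hb : 0 ≤ b) (hAB : (a • A + b • B).IsHermitian) :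
    a * eigMax hA + b * eigMin hB ∈ Set.Icc (eigMin hAB) (eigMax hAB) := by
  have key (v : EuclideanSpace ℝ m) : ⟪v, (a • A + b • B).toEuclideanLin v⟫ =
      a * ⟪v, A.toEuclideanLin v⟫ + b * ⟪v, B.toEuclideanLin v⟫ := by
    simp only [map_add, map_smul, LinearMap.add_apply, LinearMap.smul_apply, inner_add_right,
      real_inner_smul_right]
  constructor
  · obtain ⟨v, hv, hvB⟩ := hB.exists_inner_eq_eigMin
    refine (hAB.le_inner_toEuclideanLin hv).trans ?_
    rw [key, hvB]
    gcongr
    exact hA.inner_toEuclideanLin_le hv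
  · obtain ⟨v, hv, hvA⟩ := hA.exists_inner_eq_eigMax
    refine le_trans ?_ (hAB.inner_toEuclideanLin_le hv)
    rw [key, hvA]
    gcongr
    exact hB.le_inner_toEuclideanLin hv

end IsHermitian

end Matrix

/-- For symmetric zero-diagonal layers and `κ ∈ [0,1]`, if
`|κ λ_max(G¹) + (1−κ) λ_min(G²)| ≥ 1` or `|κ λ_min(G¹) + (1−κ) λ_max(G²)| ≥ 1`, then
`ρ(κ G¹ + (1−κ) G²) ≥ 1` (so a multiplex game of strategic complements with this matrix
has no Nash equilibrium). -/
theorem multiplex_complements_nonexistence {N : ℕ} (G1 G2 : Matrix (Fin N) (Fin N) ℝ)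
    (hG1 : G1.IsHermitian) (hG2 : G2.IsHermitian)
    (hd1 : ∀ i, G1 i i = 0) (hd2 : ∀ i, G2 i i = 0)
    (κ : ℝ) (hκ : κ ∈ Set.Icc (0 : ℝ) 1)
    (h : 1 ≤ |κ * eigMax hG1 + (1 - κ) * eigMin hG2| ∨
         1 ≤ |κ * eigMin hG1 + (1 - κ) * eigMax hG2|) :
    (1 : ℝ≥0∞) ≤ specRad (κ • G1 + (1 - κ) • G2) := by
  have hP : (κ • G1 + (1 - κ) • G2).IsHermitian :=
    (hG1.smul (IsSelfAdjoint.all κ)).add (hG2.smul (IsSelfAdjoint.all (1 - κ)))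
  have hκ' : 0 ≤ 1 - κ := sub_nonneg.mpr hκ.2
  rcases isEmpty_or_nonempty (Fin N) with hN | hN
  · norm_num [eigMax, eigMin, Real.iSup_of_isEmpty, Real.iInf_of_isEmpty] at h
  rcases h with h | h
  · exact hP.one_le_specRad_of_mem_Icc h (hG1.add_eigMax_eigMin_mem_Icc hG2 hκ.1 hκ' hP)
  · have hP' : ((1 - κ) • G2 + κ • G1).IsHermitian := by rwa [add_comm]
    rw [add_comm] at h ⊢
    exact hP'.one_le_specRad_of_mem_Icc h (hG2.add_eigMax_eigMin_mem_Icc hG1 hκ' hκ.1 hP')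
end
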